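/- In the partition algebra A_k(z) (k ≥ 4): for every i with 3 ≤ i ≤ k−1 the element σ_{i+1} commutes with each of p_{i−3/2}, s_{i−2}, and p_{i−2}. -/

import Mathlib

open Polynomial

/-- Elements of an algebra over `R = ℤ[z]` (with `z = Polynomial.X`) satisfying the
defining relations of the partition algebra `A_k(z)` of Halverson–Ram.
Here `p i` stands for the generator `p_i` (for `1 ≤ i ≤ k`), `q i` stands for the
half-integer generator `p_{i+1/2}` (for `1 ≤ i ≤ k-1`), and `s i` stands for `s_i`
(for `1 ≤ i ≤ k-1`). -/
structure PartitionAlgebra (k : ℕ) (A : Type*) [Ring A] [Algebra (Polynomial ℤ) A] where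
  p : ℕ → A
  q : ℕ → A
  s : ℕ → A
  s_sq : ∀ i, 1 ≤ i → i ≤ k - 1 → s i * s i = 1
  s_comm : ∀ i j, 1 ≤ i → i ≤ k - 1 → 1 ≤ j → j ≤ k - 1 → j ≠ i + 1 → i ≠ j + 1 →
    s i * s j = s j * s i
  braid : ∀ i, 1 ≤ i → i + 1 ≤ k - 1 →
    s i * s (i + 1) * s i = s (i + 1) * s i * s (i + 1)
  p_sq : ∀ i, 1 ≤ i → i ≤ k → p i * p i = (X : Polynomial ℤ) • p i
  q_sq : ∀ i, 1 ≤ i → i ≤ k - 1 → q i * q i = q i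
  s_q : ∀ i, 1 ≤ i → i ≤ k - 1 → s i * q i = q i
  q_s : ∀ i, 1 ≤ i → i ≤ k - 1 → q i * s i = q i
  s_pp : ∀ i, 1 ≤ i → i ≤ k - 1 → s i * (p i * p (i + 1)) = p i * p (i + 1)
  pp_s : ∀ i, 1 ≤ i → i ≤ k - 1 → p i * p (i + 1) * s i = p i * p (i + 1)
  p_comm : ∀ i j, 1 ≤ i → i ≤ k → 1 ≤ j → j ≤ k → p i * p j = p j * p i
  q_comm : ∀ i j, 1 ≤ i → i ≤ k - 1 → 1 ≤ j → j ≤ k - 1 → q i * q j = q j * q i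
  q_p : ∀ i j, 1 ≤ i → i ≤ k - 1 → 1 ≤ j → j ≤ k → j ≠ i → j ≠ i + 1 →
    q i * p j = p j * q i
  s_p : ∀ i j, 1 ≤ i → i ≤ k - 1 → 1 ≤ j → j ≤ k → j ≠ i → j ≠ i + 1 →
    s i * p j = p j * s i
  s_q' : ∀ i j, 1 ≤ i → i ≤ k - 1 → 1 ≤ j → j ≤ k - 1 → j + 1 ≠ i → j ≠ i + 1 →
    s i * q j = q j * s i
  sps : ∀ i, 1 ≤ i → i ≤ k - 1 → s i * p i * s i = p (i + 1)
  sqs : ∀ i, 2 ≤ i → i ≤ k - 1 →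
    s i * q (i - 1) * s i = s (i - 1) * q i * s (i - 1)
  qpq₁ : ∀ i, 1 ≤ i → i ≤ k - 1 → q i * p i * q i = q i
  qpq₂ : ∀ i, 1 ≤ i → i ≤ k - 1 → q i * p (i + 1) * q i = q i
  pqp₁ : ∀ i, 2 ≤ i → i ≤ k → p i * q (i - 1) * p i = p i
  pqp₂ : ∀ i, 1 ≤ i → i ≤ k - 1 → p i * q i * p i = p i

namespace PartitionAlgebra

variable {k : ℕ} {A : Type*} [Ring A] [Algebra (Polynomial ℤ) A]

/-- `(P.LS i).1 = L_i` and `(P.LS i).2 = σ_i` (with the junk value `σ_0 := 1`). -/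
def LS (P : PartitionAlgebra k A) : ℕ → A × A
  | 0 => (0, 1)
  | 1 => (P.p 1, 1)
  | n + 2 =>
    let Lp := (P.LS (n + 1)).1
    let sp := (P.LS (n + 1)).2
    let Lpp := (P.LS n).1
    let snew : A :=
      if n = 0 then P.s 1
      else
        P.s n * P.s (n + 1) * sp * P.s (n + 1) * P.s n
          + P.s (n + 1) * P.q n * Lpp * P.s (n + 1) * P.q n * P.s (n + 1)
          + P.q n * Lpp * P.s (n + 1) * P.q n
          - P.s (n + 1) * P.q n * Lpp * P.s n * P.q (n + 1) * P.p (n + 1) * P.q n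
          - P.q n * P.p (n + 1) * P.q (n + 1) * P.s n * Lpp * P.q n * P.s (n + 1)
    (-(P.s (n + 1) * Lp * P.q (n + 1)) - P.q (n + 1) * Lp * P.s (n + 1)
        + P.q (n + 1) * Lp * P.p (n + 2) * P.q (n + 1)
        + P.s (n + 1) * Lp * P.s (n + 1) + snew,
      snew)

/-- The Jucys–Murphy element `L_i` of the partition algebra. -/
def L (P : PartitionAlgebra k A) (i : ℕ) : A := (P.LS i).1

/-- The element `σ_i` of the partition algebra. -/
def sig (P : PartitionAlgebra k A) (i : ℕ) : A := (P.LS i).2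

/-- `(P.LSh i).1 = L_{i+1/2}` and `(P.LSh i).2 = σ_{i+1/2}`. -/
def LSh (P : PartitionAlgebra k A) : ℕ → A × A
  | 0 => (0, 1)
  | 1 =>
    (-(P.L 1 * P.q 1) - P.q 1 * P.L 1 + P.q 1 * P.L 1 * P.p 1 * P.q 1
        + P.s 1 * (0 : A) * P.s 1 + 1, 1)
  | n + 2 =>
    let Lhp := (P.LSh (n + 1)).1
    let shp := (P.LSh (n + 1)).2
    let snew : A :=
      P.s (n + 1) * P.s (n + 2) * shp * P.s (n + 2) * P.s (n + 1)
        + P.q (n + 1) * P.L (n + 1) * P.s (n + 2) * P.q (n + 1) * P.s (n + 2)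
        + P.s (n + 2) * P.q (n + 1) * P.L (n + 1) * P.s (n + 2) * P.q (n + 1)
        - P.q (n + 1) * P.L (n + 1) * P.s (n + 1) * P.q (n + 2) * P.p (n + 2) * P.q (n + 1)
        - P.s (n + 2) * P.q (n + 1) * P.p (n + 2) * P.q (n + 2) * P.s (n + 1)
            * P.L (n + 1) * P.q (n + 1) * P.s (n + 2)
    (-(P.L (n + 2) * P.q (n + 2)) - P.q (n + 2) * P.L (n + 2)
        + P.q (n + 2) * P.L (n + 2) * P.p (n + 2) * P.q (n + 2)
        + P.s (n + 2) * Lhp * P.s (n + 2) + snew,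
      snew)

/-- The half-integer Jucys–Murphy element `L_{i+1/2}` of the partition algebra. -/
def Lh (P : PartitionAlgebra k A) (i : ℕ) : A := (P.LSh i).1

/-- The element `σ_{i+1/2}` of the partition algebra. -/
def sigH (P : PartitionAlgebra k A) (i : ℕ) : A := (P.LSh i).2

end PartitionAlgebra


namespace PartitionAlgebra

variable {A : Type*} [Ring A]

/-- Conjugation by an involution `u`, as a ring endomorphism. -/
def conjHom (u : A) (h : u * u = 1) : A →+* A where
  toFun x := u * x * u
  map_one' := by simp [h]
  map_zero' := by simp
  map_mul' x y := by
    have : u * x * u * (u * y * u) = u * x * (u * u) * y * u := by noncomm_ring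
    rw [this, h]; noncomm_ring
  map_add' x y := by noncomm_ring

theorem conjHom_eq_iff {u : A} (h : u * u = 1) {x y : A} :
    conjHom u h x = y ↔ u * x = y * u := by
  change u * x * u = y ↔ _
  constructor
  · rintro rfl
    rw [mul_assoc, h, mul_one]
  · intro e
    rw [e, mul_assoc, h, mul_one]

theorem conjHom_conjHom {u : A} (h : u * u = 1) (x : A) :
    conjHom u h (conjHom u h x) = x := by
  change u * (u * x * u) * u = x
  rw [show u * (u * x * u) * u = (u * u) * x * (u * u) by noncomm_ring, h, one_mul, mul_one]

/-- The relations between `Q i j` and `p i`, `p j`. -/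
structure PairRel (x a b : A) : Prop where
  sq : x * x = x
  qpq_left : x * a * x = x
  qpq_right : x * b * x = x
  pqp_left : a * x * a = a
  pqp_right : b * x * b = b

theorem PairRel.map {x a b : A} (h : PairRel x a b) (f : A →+* A) :
    PairRel (f x) (f a) (f b) := by
  constructor <;> simp only [← map_mul, h.sq, h.qpq_left, h.qpq_right, h.pqp_left, h.pqp_right]

/-- The relations between `x = Q i j`, `y = Q i l`, `z = Q j l` and `a = p i`, `b = p j`,
`c = p l`, where `i < j < l`. -/
structure TripleRel (x y z a b c : A) : Prop where
  comm_xy : Commute x y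
  comm_xz : Commute x z
  comm_yz : Commute y z
  xz_eq_xy : x * z = x * y
  xz_eq_yz : x * z = y * z
  comm_az : Commute a z
  comm_by : Commute b y
  comm_cx : Commute c x

theorem TripleRel.map {x y z a b c : A} (h : TripleRel x y z a b c) (f : A →+* A) :
    TripleRel (f x) (f y) (f z) (f a) (f b) (f c) where
  comm_xy := h.comm_xy.map f
  comm_xz := h.comm_xz.map f
  comm_yz := h.comm_yz.map f
  xz_eq_xy := by simp only [← map_mul, h.xz_eq_xy]
  xz_eq_yz := by simp only [← map_mul, h.xz_eq_yz]
  comm_az := h.comm_az.map f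
  comm_by := h.comm_by.map f
  comm_cx := h.comm_cx.map f

/-- The six elements `Q _ _` attached to four vertices commute in disjoint pairs. -/
structure QuadRel (x₁ x₂ y₁ y₂ z₁ z₂ : A) : Prop where
  comm_x : Commute x₁ x₂
  comm_y : Commute y₁ y₂
  comm_z : Commute z₁ z₂

theorem QuadRel.map {x₁ x₂ y₁ y₂ z₁ z₂ : A} (h : QuadRel x₁ x₂ y₁ y₂ z₁ z₂) (f : A →+* A) :
    QuadRel (f x₁) (f x₂) (f y₁) (f y₂) (f z₁) (f z₂) :=
  ⟨h.comm_x.map f, h.comm_y.map f, h.comm_z.map f⟩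

/-- For commuting `e`, `f`, the element modelling the transposition of two values
at a single tensor position. -/
def twist (e f p : A) : A := 1 - e - f + e * p * f + f * p * e

theorem twist_comm (e f p : A) : twist e f p = twist f e p := by
  unfold twist; abel

theorem map_twist (g : A →+* A) (e f p : A) :
    g (twist e f p) = twist (g e) (g f) (g p) := by
  simp [twist]

theorem commute_twist {x e f p : A} (he : Commute x e) (hf : Commute x f) (hp : Commute x p) :
    Commute x (twist e f p) := by
  unfold twist
  exact ((((Commute.one_right x).sub_right he).sub_right hf).add_right
    ((he.mul_right hp).mul_right hf)).add_right ((hf.mul_right hp).mul_right he)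

theorem mul_twist {e f p : A} (h1 : e * e = e) (h2 : e * p * e = e) (hc : Commute e f) :
    e * twist e f p = e * p * f := by
  calc e * twist e f p = e - e * e - e * f + e * e * p * f + (e * f) * p * e := by
        unfold twist; noncomm_ring
    _ = e - e - e * f + e * p * f + f * (e * p * e) := by rw [h1]; rw [hc.eq]; noncomm_ring
    _ = e * p * f := by rw [h2, hc.eq]; abel

theorem twist_mul {e f p : A} (h1 : f * f = f) (h2 : f * p * f = f) (hc : Commute e f) :
    twist e f p * f = e * p * f := by
  calc twist e f p * f = f - e * f - f * f + e * p * (f * f) + f * p * (e * f) := by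
        unfold twist; noncomm_ring
    _ = f - e * f - f + e * p * f + (f * p * f) * e := by rw [h1]; rw [hc.eq]; noncomm_ring
    _ = e * p * f := by rw [h2, hc.eq]; abel

theorem commute_p_twist {e f p : A} (he : p * e * p = p) (hf : p * f * p = p) :
    Commute p (twist e f p) := by
  have h1 : p * twist e f p = p - p * e - p * f + (p * e * p) * f + (p * f * p) * e := by
    unfold twist; noncomm_ring
  have h2 : twist e f p * p = p - e * p - f * p + e * (p * f * p) + f * (p * e * p) := by
    unfold twist; noncomm_ring
  rw [he, hf] at h1 h2
  rw [commute_iff_eq, h1, h2]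
  abel

theorem mul_twist_congr {x e f e' f' p : A} (he : x * e = x * e') (hf : x * f = x * f')
    (ce : Commute x e') (cf : Commute x f') (cp : Commute x p) :
    x * twist e f p = x * twist e' f' p := by
  have aux : ∀ {e f e' f' : A}, x * e = x * e' → x * f = x * f' → Commute x e' →
      x * (e * p * f) = x * (e' * p * f') := by
    intro e f e' f' he hf ce
    have hc : Commute x (e' * p) := ce.mul_right cp
    calc x * (e * p * f) = x * e * p * f := by noncomm_ring
      _ = x * (e' * p) * f := by rw [he]; noncomm_ring
      _ = e' * p * (x * f) := by rw [hc.eq, mul_assoc]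
      _ = (e' * p * x) * f' := by rw [hf, mul_assoc _ x f']
      _ = x * (e' * p * f') := by rw [← hc.eq]; noncomm_ring
  simp only [twist, mul_add, mul_sub, aux he hf ce, aux hf he cf, he, hf]

/-- Twists at two positions jointly commute with the element `q` joining the positions. -/
theorem commute_twist_mul_twist {q e f p e' f' p' : A}
    (hqe : q * e = e * e') (hqe' : q * e' = e * e') (hqf : q * f = f * f')
    (hqf' : q * f' = f * f') (ce : Commute q e) (ce' : Commute q e') (cf : Commute q f)
    (cf' : Commute q f')
    (he : e * e = e) (hf : f * f = f) (he' : e' * e' = e') (hf' : f' * f' = f')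
    (hep : e * p * e = e) (hfp : f * p * f = f) (hep' : e' * p' * e' = e')
    (hfp' : f' * p' * f' = f')
    (hef : Commute e f) (hef' : Commute e' f')
    (cef : Commute e f') (cfe : Commute f e')
    (cep : Commute e p') (cfp : Commute f p') (cpe : Commute p e') (cpf : Commute p f') :
    Commute q (twist e f p * twist e' f' p') := by
  have a1 : e' * twist e' f' p' = e' * p' * f' := mul_twist he' hep' hef'
  have a2 : f' * twist e' f' p' = f' * p' * e' := by
    rw [twist_comm]; exact mul_twist hf' hfp' hef'.symm
  have b1 : twist e f p * f = e * p * f := twist_mul hf hfp hef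
  have b2 : twist e f p * e = f * p * e := by
    rw [twist_comm]; exact twist_mul he hep hef.symm
  have l1 : q * (e * p * f) = e * p * f * e' := by
    rw [mul_assoc, ← mul_assoc, hqe, mul_assoc, (cpe.symm.mul_right cfe.symm).eq]
    noncomm_ring
  have l2 : q * (f * p * e) = f * p * e * f' := by
    rw [mul_assoc, ← mul_assoc, hqf, mul_assoc, (cpf.symm.mul_right cef.symm).eq]
    noncomm_ring
  have l3 : q * (e' * p' * f') = e * (e' * p' * f') := by
    rw [mul_assoc, ← mul_assoc, hqe', mul_assoc]
  have l4 : q * (f' * p' * e') = f * (f' * p' * e') := by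
    rw [mul_assoc, ← mul_assoc, hqf', mul_assoc]
  have r1 : e' * p' * f' * q = f * (e' * p' * f') := by
    rw [mul_assoc, ← cf'.eq, hqf', ← mul_assoc, ← (cfe.mul_right cfp).eq]
    noncomm_ring
  have r2 : f' * p' * e' * q = e * (f' * p' * e') := by
    rw [mul_assoc, ← ce'.eq, hqe', ← mul_assoc, ← (cef.mul_right cep).eq]
    noncomm_ring
  have r3 : e * p * f * q = e * p * f * f' := by rw [mul_assoc, ← cf.eq, hqf, ← mul_assoc]
  have r4 : f * p * e * q = f * p * e * e' := by rw [mul_assoc, ← ce.eq, hqe, ← mul_assoc]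
  have hl : q * (twist e f p * twist e' f' p') = q - e * e' - f * f'
      + e * p * f * (e' * p' * f') + f * p * e * (f' * p' * e') := by
    have h1 : q * twist e f p = q - e * e' - f * f' + e * p * f * e' + f * p * e * f' := by
      simp only [twist, mul_add, mul_sub, mul_one, l1, l2, hqe, hqf]
    have h2 : q * twist e' f' p' = q - e * e' - f * f' + e * (e' * p' * f')
        + f * (f' * p' * e') := by
      simp only [twist, mul_add, mul_sub, mul_one, l3, l4, hqe', hqf']
    rw [← mul_assoc, h1]
    simp only [add_mul, sub_mul, mul_assoc _ e' (twist _ _ _), mul_assoc _ f' (twist _ _ _),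
      a1, a2, h2]
    abel
  have hr : twist e f p * twist e' f' p' * q = q - e * e' - f * f'
      + e * p * f * (e' * p' * f') + f * p * e * (f' * p' * e') := by
    have h1 : twist e' f' p' * q = q - e * e' - f * f' + f * (e' * p' * f')
        + e * (f' * p' * e') := by
      simp only [twist, add_mul, sub_mul, one_mul, r1, r2, ← ce'.eq, ← cf'.eq, hqe', hqf']
    have h2 : twist e f p * q = q - e * e' - f * f' + e * p * f * f' + f * p * e * e' := by
      simp only [twist, add_mul, sub_mul, one_mul, r3, r4, ← ce.eq, ← cf.eq, hqe, hqf]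
    rw [mul_assoc, h1]
    simp only [mul_add, mul_sub, ← mul_assoc (twist _ _ _), b1, b2, h2]
    abel
  rw [commute_iff_eq, hl, hr]

/-- The ring identity behind `mul_L_mul_step`, with `e`, `f`, `p` attached to one position,
`e'`, `f'`, `p'` to the next one, and `s`, `q` to the pair of both. -/
theorem sandwich_step {s q L σ Y e f p e' f' p' : A}
    (hss : s * s = 1) (hse : s * e = e' * s) (hsf : s * f = f' * s) (hsp : s * p = p' * s)
    (hsq : s * q = q) (hqs : q * s = q)
    (hqe : q * e' = e * e') (hqf : q * f' = f * f')
    (ceq : Commute q e')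
    (cYs : Commute s Y) (cYe : Commute Y e') (cYp : Commute Y p')
    (cL : Commute L p')
    (cee : Commute e e') (cef : Commute e f') (cfe : Commute f e')
    (cpe : Commute p e') (cpf : Commute p f') (cep : Commute e p') (cfp : Commute f p')
    (cpp : Commute p p')
    (hE : e * L * f = Y * (e * p * f)) (hσ : e' * σ * f' = Y * (s * e * f'))
    (hspp : s * (p * p') = p * p') (hep : e * p * e = e) (hfp : f' * p' * f' = f') :
    e' * (-(s * L * q) - q * L * s + q * L * p' * q + s * L * s + σ) * f' =
      Y * twist e f p * (e' * p' * f') := by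
  have hes : e * s = s * e' := by
    calc e * s = s * s * e * s := by rw [hss, one_mul]
      _ = s * (e' * (s * s)) := by rw [mul_assoc s s e, hse]; noncomm_ring
      _ = s * e' := by rw [hss, mul_one]
  have hfs : f * s = s * f' := by
    calc f * s = s * s * f * s := by rw [hss, one_mul]
      _ = s * (f' * (s * s)) := by rw [mul_assoc s s f, hsf]; noncomm_ring
      _ = s * f' := by rw [hss, mul_one]
  have hps : p * s = s * p' := by
    calc p * s = s * s * p * s := by rw [hss, one_mul]
      _ = s * (p' * (s * s)) := by rw [mul_assoc s s p, hsp]; noncomm_ring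
      _ = s * p' := by rw [hss, mul_one]
  have hmove : s * (e * p * f) = e' * p' * f' * s := by
    rw [← mul_assoc, ← mul_assoc, hse, mul_assoc e', hsp, ← mul_assoc, mul_assoc, hsf, ← mul_assoc]
  have hsff : s * (f * f') = f * f' := by rw [← hqf, ← mul_assoc, hsq]
  have hees : e * e' * s = e * e' := by rw [← hqe, ceq.eq, mul_assoc, hqs]
  have t1 : e' * (s * L * q) * f' = Y * (f * (e' * p' * f')) := by
    calc e' * (s * L * q) * f' = (e' * s) * L * (q * f') := by noncomm_ring
      _ = s * (e * L * f) * f' := by rw [← hse, hqf]; noncomm_ring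
      _ = (s * Y) * (e * p * f) * f' := by rw [hE]; noncomm_ring
      _ = Y * (s * (e * p * f)) * f' := by rw [cYs.eq]; noncomm_ring
      _ = Y * (e' * p' * (f' * s) * f') := by rw [hmove]; noncomm_ring
      _ = Y * (e' * p' * (s * (f * f'))) := by rw [← hsf]; noncomm_ring
      _ = Y * (e' * p' * f * f') := by rw [hsff]; noncomm_ring
      _ = Y * (f * (e' * p' * f')) := by
        rw [← (cfe.mul_right cfp).eq]; noncomm_ring
  have t2 : e' * (q * L * s) * f' = Y * (e * (e' * p' * f')) := by
    calc e' * (q * L * s) * f' = (e' * q) * L * (s * f') := by noncomm_ring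
      _ = (e' * e) * L * (f * s) := by rw [← ceq.eq, hqe, cee.eq, hfs]
      _ = e' * (e * L * f) * s := by noncomm_ring
      _ = (e' * Y) * e * p * (f * s) := by rw [hE]; noncomm_ring
      _ = Y * e' * e * (p * s) * f' := by rw [← cYe.eq, hfs]; noncomm_ring
      _ = Y * (e * e' * s) * p' * f' := by rw [hps, cee.eq]; noncomm_ring
      _ = Y * (e * (e' * p' * f')) := by rw [hees]; noncomm_ring
  have t3 : e' * (q * L * p' * q) * f' = Y * (e * p * f * (e' * p' * f')) := by
    calc e' * (q * L * p' * q) * f' = (e' * q) * (L * p') * (q * f') := by noncomm_ring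
      _ = e' * (e * p') * L * f * f' := by rw [← ceq.eq, hqe, cL.eq, hqf, cee.eq]; noncomm_ring
      _ = e' * p' * (e * L * f) * f' := by rw [cep.eq]; noncomm_ring
      _ = (e' * p' * Y) * (e * p * f) * f' := by rw [hE]; noncomm_ring
      _ = Y * ((e' * p') * (e * p * f)) * f' := by rw [← (cYe.mul_right cYp).eq]; noncomm_ring
      _ = Y * (e * p * f * (e' * p' * f')) := by
        rw [← (((cee.mul_right cep).mul_left (cpe.mul_right cpp)).mul_left
          (cfe.mul_right cfp)).eq]
        noncomm_ring
  have t4 : e' * (s * L * s) * f' = Y * (e' * p' * f') := by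
    calc e' * (s * L * s) * f' = (e' * s) * L * (s * f') := by noncomm_ring
      _ = s * (e * L * f) * s := by rw [← hse, ← hfs]; noncomm_ring
      _ = (s * Y) * (e * p * f) * s := by rw [hE]; noncomm_ring
      _ = Y * (s * (e * p * f)) * s := by rw [cYs.eq]; noncomm_ring
      _ = Y * (e' * p' * f') * (s * s) := by rw [hmove]; noncomm_ring
      _ = Y * (e' * p' * f') := by rw [hss, mul_one]
  have t5 : s * e * f' = f * p * e * (e' * p' * f') := by
    symm
    calc f * p * e * (e' * p' * f') = f * p * (e * (e' * p')) * f' := by noncomm_ring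
      _ = f * (p * e') * p' * e * f' := by rw [(cee.mul_right cep).eq]; noncomm_ring
      _ = f * e' * (p * p') * e * f' := by rw [cpe.eq]; noncomm_ring
      _ = f * (e' * s) * p * p' * e * f' := by rw [← hspp]; noncomm_ring
      _ = (f * s) * e * p * p' * e * f' := by rw [← hse]; noncomm_ring
      _ = s * (f' * (e * p)) * (p' * e) * f' := by rw [hfs]; noncomm_ring
      _ = s * (e * p * e) * (f' * p' * f') := by
        rw [← (cef.mul_left cpf).eq, ← cep.eq,
          show s * (e * p * f') * (e * p') * f' = s * e * p * (f' * e) * p' * f' by noncomm_ring,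
          ← cef.eq]
        noncomm_ring
      _ = s * e * f' := by rw [hep, hfp, mul_assoc]
  calc e' * (-(s * L * q) - q * L * s + q * L * p' * q + s * L * s + σ) * f'
      = -(e' * (s * L * q) * f') - e' * (q * L * s) * f' + e' * (q * L * p' * q) * f'
        + e' * (s * L * s) * f' + e' * σ * f' := by noncomm_ring
    _ = Y * twist e f p * (e' * p' * f') := by
      rw [t1, t2, t3, t4, hσ, t5]
      unfold twist
      noncomm_ring

theorem sigma_step {s t L S q' e f p p' Y Y₀ : A} (hs : s * s = 1) (ht : t * t = 1)
    (hbr : s * t * s = t * s * t)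
    (hX : s * S = Y₀) (hY : conjHom s hs (conjHom t ht Y₀) = Y)
    (hab : e * L * f = Y * (e * p * f)) (hba : f * L * e = Y * (f * p * e))
    (hepe : e * p * e = e) (hpfp : p * f * p = p) (hfpf : f * p * f = f) (hpep : p * e * p = p)
    (hfe : s * f = q' * s) (hef : t * e = f * t) (hp : s * p = p' * s) (hp' : t * p = p * t)
    (cL : Commute t L) (hse : s * e = e) (hes : e * s = e) (cY : Commute (f * p) Y) :
    t * (s * t * S * t * s + t * e * L * t * e * t + e * L * t * e - t * e * L * s * q' * p' * e
      - e * p' * q' * s * L * e * t) = Y * twist e f p := by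
  have hfs : f * s = s * q' := by
    calc f * s = s * s * f * s := by rw [hs, one_mul]
      _ = s * (q' * (s * s)) := by rw [mul_assoc s s f, hfe]; noncomm_ring
      _ = s * q' := by rw [hs, mul_one]
  have hps : p * s = s * p' := by
    calc p * s = s * s * p * s := by rw [hs, one_mul]
      _ = s * (p' * (s * s)) := by rw [mul_assoc s s p, hp]; noncomm_ring
      _ = s * p' := by rw [hs, mul_one]
  have het : e * t = t * f := by
    calc e * t = t * t * e * t := by rw [ht, one_mul]
      _ = t * (f * (t * t)) := by rw [mul_assoc t t e, hef]; noncomm_ring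
      _ = t * f := by rw [ht, mul_one]
  have htet : t * e * t = f := by rw [hef, mul_assoc, ht, mul_one]
  have u1 : t * (s * t * S * t * s) = Y := by
    calc t * (s * t * S * t * s) = (t * s * t) * S * t * s := by noncomm_ring
      _ = s * (t * (s * S) * t) * s := by rw [← hbr]; noncomm_ring
      _ = Y := by rw [hX]; exact hY
  have u2 : t * (t * e * L * t * e * t) = Y * (e * p * f) := by
    calc t * (t * e * L * t * e * t) = (t * t) * e * L * (t * e * t) := by noncomm_ring
      _ = Y * (e * p * f) := by rw [ht, one_mul, htet, hab]
  have u3 : t * (e * L * t * e) = Y * (f * p * e) := by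
    calc t * (e * L * t * e) = (t * e) * L * t * e := by noncomm_ring
      _ = f * (t * L) * t * e := by rw [hef]; noncomm_ring
      _ = f * L * (t * t) * e := by rw [cL.eq]; noncomm_ring
      _ = Y * (f * p * e) := by rw [ht, mul_one, hba]
  have u4 : t * (t * e * L * s * q' * p' * e) = Y * e := by
    calc t * (t * e * L * s * q' * p' * e) = (t * t) * e * L * (s * q') * p' * e := by
          noncomm_ring
      _ = e * L * f * (s * p') * e := by rw [ht, ← hfs]; noncomm_ring
      _ = (e * L * f) * p * (s * e) := by rw [← hps]; noncomm_ring
      _ = Y * (e * (p * f * p) * e) := by rw [hab, hse]; noncomm_ring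
      _ = Y * e := by rw [hpfp, hepe]
  have u5 : t * (e * p' * q' * s * L * e * t) = Y * f := by
    calc t * (e * p' * q' * s * L * e * t) = t * e * p' * (q' * s) * L * e * t := by noncomm_ring
      _ = t * e * (p' * s) * f * L * e * t := by rw [← hfe]; noncomm_ring
      _ = t * (e * s) * p * f * L * e * t := by rw [← hp]; noncomm_ring
      _ = (t * e) * p * f * L * e * t := by rw [hes]
      _ = f * (t * p) * f * L * e * t := by rw [hef]; noncomm_ring
      _ = f * p * (t * f) * L * e * t := by rw [hp']; noncomm_ring
      _ = f * p * e * (t * L) * e * t := by rw [← het]; noncomm_ring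
      _ = f * p * e * L * (t * e * t) := by rw [cL.eq]; noncomm_ring
      _ = f * p * (e * L * f) := by rw [htet]; noncomm_ring
      _ = (f * p * Y) * (e * p * f) := by rw [hab]; noncomm_ring
      _ = Y * (f * (p * e * p) * f) := by rw [cY.eq]; noncomm_ring
      _ = Y * f := by rw [hpep, hfpf]
  rw [mul_sub, mul_sub, mul_add, mul_add, u1, u2, u3, u4, u5]
  unfold twist
  noncomm_ring

variable {k : ℕ} [Algebra (Polynomial ℤ) A]

/-- The diagram element joining the vertices `i` and `j` for `i < j`, so that
`Q i (i + 1) = p_{i+1/2}`. -/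
def Q (P : PartitionAlgebra k A) (i : ℕ) : ℕ → A
  | 0 => 1
  | j + 1 => if i = j then P.q i else P.s j * Q P i j * P.s j

theorem Q_succ_self (P : PartitionAlgebra k A) (i : ℕ) : P.Q i (i + 1) = P.q i := by
  simp [Q]

theorem conj_Q_right (P : PartitionAlgebra k A) {i j : ℕ} (hij : i < j)
    (h : P.s j * P.s j = 1) : conjHom (P.s j) h (P.Q i j) = P.Q i (j + 1) := by
  simp [Q, conjHom, hij.ne]

theorem s_sq' (P : PartitionAlgebra k A) {m : ℕ} (h1 : 1 ≤ m) (h2 : m < k) :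
    P.s m * P.s m = 1 := P.s_sq m h1 (by omega)

theorem s_braid (P : PartitionAlgebra k A) {m : ℕ} (h1 : 1 ≤ m) (h2 : m + 1 < k) :
    P.s m * P.s (m + 1) * P.s m = P.s (m + 1) * P.s m * P.s (m + 1) :=
  P.braid m h1 (by omega)

theorem conj_Q_left (P : PartitionAlgebra k A) {i j : ℕ} (hi : 1 ≤ i) (hij : i + 1 < j)
    (hj : j ≤ k) (h : P.s i * P.s i = 1) :
    conjHom (P.s i) h (P.Q i j) = P.Q (i + 1) j := by
  induction j, hij using Nat.le_induction with
  | base =>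
    have h1 := P.sqs (i + 1) (by omega) (by omega)
    rw [Nat.add_sub_cancel] at h1
    have : P.Q i (i + 1 + 1) = conjHom (P.s i) h (P.q (i + 1)) := by
      change _ = P.s i * P.q (i + 1) * P.s i
      rw [← h1]
      simp [Q]
    rw [Q_succ_self, this, conjHom_conjHom]
  | succ j hij ih =>
    have hs := P.s_sq' (m := j) (by omega) (by omega)
    have hc := P.s_comm i j hi (by omega) (by omega) (by omega) (by omega) (by omega)
    rw [← P.conj_Q_right (by omega) hs, ← P.conj_Q_right (i := i + 1) (by omega) hs,
      ← ih (by omega)]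
    change P.s i * (P.s j * P.Q i j * P.s j) * P.s i = P.s j * (P.s i * P.Q i j * P.s i) * P.s j
    calc _ = (P.s i * P.s j) * P.Q i j * (P.s j * P.s i) := by noncomm_ring
      _ = (P.s j * P.s i) * P.Q i j * (P.s i * P.s j) := by rw [hc]
      _ = _ := by noncomm_ring

/-- Transpositions away from the vertices `i` and `j` commute with `Q i j`. -/
theorem commute_s_Q (P : PartitionAlgebra k A) {i j m : ℕ} (hi : 1 ≤ i) (hij : i < j)
    (hj : j ≤ k) (hm : 1 ≤ m) (hmk : m < k) (h1 : m ≠ i) (h2 : m + 1 ≠ i) (h3 : m ≠ j)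
    (h4 : m + 1 ≠ j) : Commute (P.s m) (P.Q i j) := by
  induction j using Nat.strong_induction_on with
  | _ j ih =>
  obtain ⟨j, rfl⟩ : ∃ j', j = j' + 1 := ⟨j - 1, by omega⟩
  rcases eq_or_ne i j with rfl | hne
  · rw [Q_succ_self]
    exact P.s_q' m i hm (by omega) hi (by omega) (by omega) (by omega)
  have hs := P.s_sq' (m := j) (by omega) (by omega)
  by_cases hmj : m + 1 = j
  · subst hmj
    have hs' := P.s_sq' hm hmk
    have hb := P.s_braid hm (by omega)
    have hc : Commute (P.s (m + 1)) (P.Q i m) := by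
      rcases lt_or_ge k (m + 1) with h | h
      · omega
      have key : ∀ m', m' ≤ m → i < m' → Commute (P.s (m + 1)) (P.Q i m') := by
        intro m' hm' him'
        induction m', him' using Nat.le_induction with
        | base =>
          rw [Q_succ_self]
          exact P.s_q' _ _ (by omega) (by omega) hi (by omega) (by omega) (by omega)
        | succ m' him' ih' =>
          have hs'' := P.s_sq' (m := m') (by omega) (by omega)
          rw [← P.conj_Q_right (by omega) hs'']
          have c : Commute (P.s (m + 1)) (P.s m') :=
            P.s_comm _ _ (by omega) (by omega) (by omega) (by omega) (by omega) (by omega)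
          exact (c.mul_right (ih' (by omega))).mul_right c
      exact key m le_rfl (by omega)
    rw [← P.conj_Q_right (by omega) hs, ← P.conj_Q_right (by omega) hs']
    generalize P.Q i m = x at *
    change P.s m * (P.s (m + 1) * (P.s m * x * P.s m) * P.s (m + 1)) =
      P.s (m + 1) * (P.s m * x * P.s m) * P.s (m + 1) * P.s m
    calc _ = (P.s m * P.s (m + 1) * P.s m) * x * P.s m * P.s (m + 1) := by noncomm_ring
      _ = P.s (m + 1) * P.s m * (P.s (m + 1) * x) * P.s m * P.s (m + 1) := by
        rw [hb]; noncomm_ring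
      _ = P.s (m + 1) * P.s m * x * (P.s (m + 1) * P.s m * P.s (m + 1)) := by
        rw [hc.eq]; noncomm_ring
      _ = _ := by rw [← hb]; noncomm_ring
  · rw [← P.conj_Q_right (by omega) hs]
    have c : Commute (P.s m) (P.s j) :=
      P.s_comm _ _ (by omega) (by omega) (by omega) (by omega) (by omega) (by omega)
    exact (c.mul_right (ih j (by omega) (by omega) (by omega) (by omega) (by omega))).mul_right c

theorem conj_Q_of_ne (P : PartitionAlgebra k A) {i j m : ℕ} (hi : 1 ≤ i) (hij : i < j)
    (hj : j ≤ k) (hm : 1 ≤ m) (hmk : m < k) (h1 : m ≠ i) (h2 : m + 1 ≠ i) (h3 : m ≠ j)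
    (h4 : m + 1 ≠ j) (h : P.s m * P.s m = 1) :
    conjHom (P.s m) h (P.Q i j) = P.Q i j :=
  (conjHom_eq_iff h).2 (P.commute_s_Q hi hij hj hm hmk h1 h2 h3 h4)

theorem conj_p_self (P : PartitionAlgebra k A) {m : ℕ} (hm : 1 ≤ m) (hmk : m < k)
    (h : P.s m * P.s m = 1) : conjHom (P.s m) h (P.p m) = P.p (m + 1) :=
  P.sps m hm (by omega)

theorem conj_p_of_ne (P : PartitionAlgebra k A) {m j : ℕ} (hm : 1 ≤ m) (hmk : m < k)
    (hj : 1 ≤ j) (hjk : j ≤ k) (h1 : j ≠ m) (h2 : j ≠ m + 1)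
    (h : P.s m * P.s m = 1) : conjHom (P.s m) h (P.p j) = P.p j :=
  (conjHom_eq_iff h).2 (P.s_p m j hm (by omega) hj hjk h1 h2)

theorem pairRel (P : PartitionAlgebra k A) {i j : ℕ} (hi : 1 ≤ i) (hij : i < j) (hj : j ≤ k) :
    PairRel (P.Q i j) (P.p i) (P.p j) := by
  induction j, hij using Nat.le_induction with
  | base =>
    rw [Q_succ_self]
    exact ⟨P.q_sq i hi (by omega), P.qpq₁ i hi (by omega), P.qpq₂ i hi (by omega),
      P.pqp₂ i hi (by omega), P.pqp₁ (i + 1) (by omega) hj⟩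
  | succ j hij ih =>
    have hs := P.s_sq' (m := j) (by omega) (by omega)
    have := (ih (by omega)).map (conjHom _ hs)
    rwa [P.conj_Q_right (by omega), P.conj_p_self (by omega) (by omega),
      P.conj_p_of_ne (by omega) (by omega) (by omega) (by omega) (by omega) (by omega)] at this

theorem tripleRel_base (P : PartitionAlgebra k A) {i : ℕ} (hi : 1 ≤ i) (hik : i + 2 ≤ k) :
    TripleRel (P.Q i (i + 1)) (P.Q i (i + 2)) (P.Q (i + 1) (i + 2))
      (P.p i) (P.p (i + 1)) (P.p (i + 2)) := by
  have hs := P.s_sq' hi (by omega)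
  have hs' := P.s_sq' (m := i + 1) (by omega) (by omega)
  have hy : P.Q i (i + 2) = conjHom _ hs' (P.q i) := by
    rw [← P.Q_succ_self i, P.conj_Q_right (by omega)]
  have hy' : P.Q i (i + 2) = conjHom _ hs (P.q (i + 1)) := by
    rw [← P.Q_succ_self (i + 1), ← P.conj_Q_left hi (by omega) (by omega) hs, conjHom_conjHom]
  have hx : conjHom _ hs (P.q i) = P.q i :=
    (conjHom_eq_iff hs).2 (by rw [P.s_q i hi (by omega), P.q_s i hi (by omega)])
  have hz : conjHom _ hs' (P.q (i + 1)) = P.q (i + 1) :=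
    (conjHom_eq_iff hs').2 (by
      rw [P.s_q (i + 1) (by omega) (by omega), P.q_s (i + 1) (by omega) (by omega)])
  have hc : Commute (P.q i) (P.q (i + 1)) :=
    P.q_comm _ _ hi (by omega) (by omega) (by omega)
  have hp : conjHom _ hs' (P.p (i + 2)) = P.p (i + 1) := by
    rw [← P.conj_p_self (by omega) (by omega) hs', conjHom_conjHom]
  have hxs : P.q i * P.s i = P.q i := P.q_s i hi (by omega)
  have hzs : P.s (i + 1) * P.q (i + 1) = P.q (i + 1) := P.s_q _ (by omega) (by omega)
  have hq' : P.Q (i + 1) (i + 2) = P.q (i + 1) := P.Q_succ_self (i + 1)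
  rw [P.Q_succ_self i, hq']
  refine ⟨?_, ?_, ?_, ?_, ?_, ?_, ?_, ?_⟩
  · simpa only [hy', hx] using hc.map (conjHom _ hs)
  · exact hc
  · simpa only [hy, hz] using hc.map (conjHom _ hs')
  · rw [hy']
    change _ = P.q i * (P.s i * P.q (i + 1) * P.s i)
    rw [← mul_assoc, ← mul_assoc, hxs, hc.eq, mul_assoc, hxs]
  · rw [hy]
    change _ = P.s (i + 1) * P.q i * P.s (i + 1) * P.q (i + 1)
    rw [mul_assoc _ _ (P.q (i + 1)), hzs, mul_assoc, hc.eq, ← mul_assoc, hzs]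
  · exact (P.q_p _ _ (by omega) (by omega) hi (by omega) (by omega) (by omega)).symm
  · have : Commute (P.p (i + 2)) (P.q i) :=
      (P.q_p _ _ hi (by omega) (by omega) (by omega) (by omega) (by omega)).symm
    simpa only [hy, hp] using this.map (conjHom _ hs')
  · exact (P.q_p _ _ (by omega) (by omega) (by omega) (by omega) (by omega) (by omega)).symm

theorem tripleRel (P : PartitionAlgebra k A) {i j l : ℕ} (hi : 1 ≤ i) (hij : i < j)
    (hjl : j < l) (hl : l ≤ k) :
    TripleRel (P.Q i j) (P.Q i l) (P.Q j l) (P.p i) (P.p j) (P.p l) := by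
  induction j, hij using Nat.le_induction with
  | base =>
    induction l, hjl using Nat.le_induction with
    | base => exact P.tripleRel_base hi hl
    | succ l hjl ih =>
      simp only [Nat.succ_eq_add_one] at *
      have hs := P.s_sq' (m := l) (by omega) (by omega)
      have := (ih (by omega)).map (conjHom _ hs)
      rwa [P.conj_Q_right (by omega), P.conj_Q_right (by omega),
        P.conj_Q_of_ne (i := i) (by omega) (by omega) (by omega) (by omega) (by omega)
          (by omega) (by omega) (by omega) (by omega),
        P.conj_p_of_ne (by omega) (by omega) (by omega) (by omega) (by omega) (by omega),
        P.conj_p_of_ne (by omega) (by omega) (by omega) (by omega) (by omega) (by omega),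
        P.conj_p_self (by omega) (by omega)] at this
  | succ j hij ih =>
    simp only [Nat.succ_eq_add_one] at *
    have hs := P.s_sq' (m := j) (by omega) (by omega)
    have := (ih (by omega)).map (conjHom _ hs)
    rwa [P.conj_Q_right (by omega),
      P.conj_Q_of_ne (i := i) (j := l) (by omega) (by omega) (by omega) (by omega) (by omega)
        (by omega) (by omega) (by omega) (by omega),
      P.conj_Q_left (by omega) (by omega) (by omega),
      P.conj_p_of_ne (j := i) (by omega) (by omega) (by omega) (by omega) (by omega) (by omega),
      P.conj_p_self (by omega) (by omega),
      P.conj_p_of_ne (by omega) (by omega) (by omega) (by omega) (by omega) (by omega)] at this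

theorem quadRel_base (P : PartitionAlgebra k A) {i : ℕ} (hi : 1 ≤ i) (hik : i + 3 ≤ k) :
    QuadRel (P.Q i (i + 1)) (P.Q (i + 2) (i + 3)) (P.Q i (i + 2)) (P.Q (i + 1) (i + 3))
      (P.Q i (i + 3)) (P.Q (i + 1) (i + 2)) := by
  have hs := P.s_sq' (m := i + 1) (by omega) (by omega)
  have hs' := P.s_sq' (m := i + 2) (by omega) (by omega)
  have h1 : Commute (P.Q i (i + 1)) (P.Q (i + 2) (i + 3)) := by
    rw [Q_succ_self, Q_succ_self]
    exact P.q_comm _ _ hi (by omega) (by omega) (by omega)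
  have h2 : Commute (P.Q i (i + 2)) (P.Q (i + 1) (i + 3)) := by
    have := h1.map (conjHom _ hs)
    rwa [P.conj_Q_right (by omega),
      ← P.conj_Q_left (i := i + 1) (by omega) (by omega) (by omega) hs, conjHom_conjHom] at this
  refine ⟨h1, h2, ?_⟩
  have := h2.map (conjHom _ hs')
  rwa [P.conj_Q_right (by omega), ← P.conj_Q_right (i := i + 1) (j := i + 2) (by omega) hs',
    conjHom_conjHom] at this

theorem quadRel (P : PartitionAlgebra k A) {i j l m : ℕ} (hi : 1 ≤ i) (hij : i < j)
    (hjl : j < l) (hlm : l < m) (hm : m ≤ k) :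
    QuadRel (P.Q i j) (P.Q l m) (P.Q i l) (P.Q j m) (P.Q i m) (P.Q j l) := by
  induction j, hij using Nat.le_induction with
  | base =>
    induction l, hjl using Nat.le_induction with
    | base =>
      induction m, hlm using Nat.le_induction with
      | base => exact P.quadRel_base hi hm
      | succ m hlm ih =>
        simp only [Nat.succ_eq_add_one] at *
        have hs := P.s_sq' (m := m) (by omega) (by omega)
        have := (ih (by omega)).map (conjHom _ hs)
        rwa [P.conj_Q_right (by omega), P.conj_Q_right (by omega), P.conj_Q_right (by omega),
          P.conj_Q_of_ne (i := i) (j := i + 1) (by omega) (by omega) (by omega) (by omega)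
            (by omega) (by omega) (by omega) (by omega) (by omega),
          P.conj_Q_of_ne (i := i) (by omega) (by omega) (by omega) (by omega)
            (by omega) (by omega) (by omega) (by omega) (by omega),
          P.conj_Q_of_ne (i := i + 1) (by omega) (by omega) (by omega) (by omega)
            (by omega) (by omega) (by omega) (by omega) (by omega)] at this
    | succ l hjl ih =>
      simp only [Nat.succ_eq_add_one] at *
      have hs := P.s_sq' (m := l) (by omega) (by omega)
      have := (ih (by omega)).map (conjHom _ hs)
      rwa [P.conj_Q_right (by omega), P.conj_Q_right (by omega),
        P.conj_Q_left (i := l) (by omega) (by omega) (by omega),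
        P.conj_Q_of_ne (i := i) (j := i + 1) (by omega) (by omega) (by omega) (by omega)
          (by omega) (by omega) (by omega) (by omega) (by omega),
        P.conj_Q_of_ne (i := i + 1) (by omega) (by omega) (by omega) (by omega)
          (by omega) (by omega) (by omega) (by omega) (by omega),
        P.conj_Q_of_ne (i := i) (j := m) (by omega) (by omega) (by omega) (by omega)
          (by omega) (by omega) (by omega) (by omega) (by omega)] at this
  | succ j hij ih =>
    simp only [Nat.succ_eq_add_one] at *
    have hs := P.s_sq' (m := j) (by omega) (by omega)
    have := (ih (by omega)).map (conjHom _ hs)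
    rwa [P.conj_Q_right (i := i) (by omega),
      P.conj_Q_left (j := m) (by omega) (by omega) (by omega),
      P.conj_Q_left (j := l) (by omega) (by omega) (by omega),
      P.conj_Q_of_ne (i := l) (by omega) (by omega) (by omega) (by omega)
        (by omega) (by omega) (by omega) (by omega) (by omega),
      P.conj_Q_of_ne (i := i) (j := l) (by omega) (by omega) (by omega) (by omega)
        (by omega) (by omega) (by omega) (by omega) (by omega),
      P.conj_Q_of_ne (i := i) (j := m) (by omega) (by omega) (by omega) (by omega)
        (by omega) (by omega) (by omega) (by omega) (by omega)] at this

theorem commute_Q_Q (P : PartitionAlgebra k A) {i j l m : ℕ} (hi : 1 ≤ i) (hij : i < j)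
    (hj : j ≤ k) (hl : 1 ≤ l) (hlm : l < m) (hm : m ≤ k) :
    Commute (P.Q i j) (P.Q l m) := by
  wlog hil : i ≤ l generalizing i j l m
  · exact (this hl hlm hm hi hij hj (by omega)).symm
  rcases hil.eq_or_lt with rfl | hil
  · rcases lt_trichotomy j m with h | rfl | h
    · exact (P.tripleRel hi hij h hm).comm_xy
    · exact Commute.refl _
    · exact (P.tripleRel hi hlm h hj).comm_xy.symm
  rcases lt_trichotomy j l with h | rfl | h
  · exact (P.quadRel hi hij h hlm hm).comm_x
  · exact (P.tripleRel hi hij hlm hm).comm_xz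
  rcases lt_trichotomy j m with h' | rfl | h'
  · exact (P.quadRel hi hil h h' hm).comm_y
  · exact (P.tripleRel hi hil h hm).comm_yz
  · exact (P.quadRel hi hil hlm h' hj).comm_z

theorem commute_p_Q (P : PartitionAlgebra k A) {i j m : ℕ} (hi : 1 ≤ i) (hij : i < j)
    (hj : j ≤ k) (hm : 1 ≤ m) (hmk : m ≤ k) (h1 : m ≠ i) (h2 : m ≠ j) :
    Commute (P.p m) (P.Q i j) := by
  rcases h1.lt_or_gt with h1 | h1
  · exact (P.tripleRel hm h1 hij hj).comm_az
  rcases h2.lt_or_gt with h2 | h2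
  · exact (P.tripleRel hi h1 h2 hj).comm_by
  · exact (P.tripleRel hi hij h2 hmk).comm_cx

/-- The transposition of the values at the vertices `a` and `b`, applied at the vertex `j`. -/
def T (P : PartitionAlgebra k A) (j a b : ℕ) : A := twist (P.Q j a) (P.Q j b) (P.p j)

/-- The product of `T j a b` over `1 ≤ j ≤ m`. -/
def Y (P : PartitionAlgebra k A) : ℕ → ℕ → ℕ → A
  | 0, _, _ => 1
  | m + 1, a, b => Y P m a b * P.T (m + 1) a b

theorem T_comm (P : PartitionAlgebra k A) (j a b : ℕ) : P.T j a b = P.T j b a :=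
  twist_comm _ _ _

theorem Y_comm (P : PartitionAlgebra k A) (m a b : ℕ) : P.Y m a b = P.Y m b a := by
  induction m with
  | zero => rfl
  | succ m ih => simp only [Y, ih, P.T_comm _ a b]

theorem commute_Y (P : PartitionAlgebra k A) {x : A} {m a b : ℕ}
    (h : ∀ j, 1 ≤ j → j ≤ m → Commute x (P.T j a b)) : Commute x (P.Y m a b) := by
  induction m with
  | zero => exact Commute.one_right x
  | succ m ih =>
    exact (ih fun j h1 h2 => h j h1 (by omega)).mul_right (h _ (by omega) le_rfl)

theorem map_Y (P : PartitionAlgebra k A) (f : A →+* A) {m a b c d : ℕ}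
    (h : ∀ j, 1 ≤ j → j ≤ m → f (P.T j a b) = P.T j c d) : f (P.Y m a b) = P.Y m c d := by
  induction m with
  | zero => exact map_one f
  | succ m ih =>
    rw [Y, Y, map_mul, ih fun j h1 h2 => h j h1 (by omega), h _ (by omega) le_rfl]

theorem mul_Y_congr (P : PartitionAlgebra k A) {x : A} {m a b c d : ℕ}
    (hx : ∀ j, 1 ≤ j → j ≤ m → Commute x (P.T j c d))
    (h : ∀ j, 1 ≤ j → j ≤ m → x * P.T j a b = x * P.T j c d) :
    x * P.Y m a b = x * P.Y m c d := by
  induction m with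
  | zero => rfl
  | succ m ih =>
    have hc : Commute x (P.Y m c d) := P.commute_Y fun j h1 h2 => hx j h1 (by omega)
    rw [Y, Y, ← mul_assoc, ih (fun j h1 h2 => hx j h1 (by omega)) fun j h1 h2 => h j h1 (by omega),
      hc.eq, mul_assoc, h _ (by omega) le_rfl, ← mul_assoc, ← hc.eq, mul_assoc]

theorem commute_Q_T (P : PartitionAlgebra k A) {i l j a b : ℕ} (hj : 1 ≤ j) (hji : j < i)
    (hil : i < l) (hl : l ≤ k) (hja : j < a) (ha : a ≤ k) (hjb : j < b) (hb : b ≤ k) :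
    Commute (P.Q i l) (P.T j a b) :=
  commute_twist (P.commute_Q_Q (by omega) hil hl hj hja ha)
    (P.commute_Q_Q (by omega) hil hl hj hjb hb)
    (P.commute_p_Q (by omega) hil hl hj (by omega) (by omega) (by omega)).symm

theorem commute_p_T (P : PartitionAlgebra k A) {i j a b : ℕ} (hj : 1 ≤ j) (hi : 1 ≤ i)
    (hik : i ≤ k) (hij : i ≠ j) (hia : i ≠ a) (hib : i ≠ b) (hja : j < a) (ha : a ≤ k)
    (hjb : j < b) (hb : b ≤ k) : Commute (P.p i) (P.T j a b) :=
  commute_twist (P.commute_p_Q hj hja ha hi hik hij hia) (P.commute_p_Q hj hjb hb hi hik hij hib)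
    (P.p_comm _ _ hi hik hj (by omega))

theorem commute_s_T (P : PartitionAlgebra k A) {i j a b : ℕ} (hj : 1 ≤ j) (hji : j < i)
    (hia : i + 1 < a) (ha : a ≤ k) (hib : i + 1 < b) (hb : b ≤ k) :
    Commute (P.s i) (P.T j a b) :=
  commute_twist
    (P.commute_s_Q hj (by omega) ha (by omega) (by omega) (by omega) (by omega) (by omega)
      (by omega))
    (P.commute_s_Q hj (by omega) hb (by omega) (by omega) (by omega) (by omega) (by omega)
      (by omega))
    (P.s_p _ _ (by omega) (by omega) hj (by omega) (by omega) (by omega))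

theorem conj_T (P : PartitionAlgebra k A) {j a : ℕ} (hj : 1 ≤ j) (hja : j + 1 < a) (ha : a < k)
    (h : P.s a * P.s a = 1) (h' : P.s (a - 1) * P.s (a - 1) = 1) :
    conjHom _ h' (conjHom _ h (P.T j (a - 1) a)) = P.T j a (a + 1) := by
  obtain ⟨a, rfl⟩ : ∃ c, a = c + 1 := ⟨a - 1, by omega⟩
  simp only [Nat.add_sub_cancel] at *
  simp only [T, map_twist]
  rw [P.conj_Q_of_ne (m := a + 1) (j := a) (by omega) (by omega) (by omega) (by omega) (by omega)
      (by omega) (by omega) (by omega) (by omega), P.conj_Q_right (by omega),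
    P.conj_p_of_ne (m := a + 1) (by omega) (by omega) (by omega) (by omega) (by omega) (by omega),
    P.conj_p_of_ne (m := a) (by omega) (by omega) (by omega) (by omega) (by omega) (by omega),
    P.conj_Q_right (by omega),
    P.conj_Q_of_ne (m := a) (by omega) (by omega) (by omega) (by omega) (by omega)
      (by omega) (by omega) (by omega) (by omega)]

theorem commute_q_T_mul_T (P : PartitionAlgebra k A) {j l a b : ℕ} (hj : 1 ≤ j) (hjl : j < l)
    (hla : l < a) (ha : a ≤ k) (hlb : l < b) (hb : b ≤ k) :
    Commute (P.Q j l) (P.T j a b * P.T l a b) := by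
  have ta := P.tripleRel hj hjl hla ha
  have tb := P.tripleRel hj hjl hlb hb
  have ea := P.pairRel hj (hjl.trans hla) ha
  have eb := P.pairRel hj (hjl.trans hlb) hb
  have ea' := P.pairRel (hj.trans hjl.le) hla ha
  have eb' := P.pairRel (hj.trans hjl.le) hlb hb
  have c : ∀ {i i' c d : ℕ}, 1 ≤ i → 1 ≤ i' → i < c → i' < d → c ≤ k → d ≤ k →
      Commute (P.Q i c) (P.Q i' d) :=
    fun h1 h2 h3 h4 h5 h6 => P.commute_Q_Q h1 h3 h5 h2 h4 h6
  have c' : ∀ {i i' c : ℕ}, 1 ≤ i → 1 ≤ i' → i < c → c ≤ k → i' ≤ k → i' ≠ i → i' ≠ c →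
      Commute (P.p i') (P.Q i c) :=
    fun h1 h2 h3 h4 h5 h6 h7 => P.commute_p_Q h1 h3 h4 h2 h5 h6 h7
  exact commute_twist_mul_twist (ta.xz_eq_xy.symm.trans (ta.xz_eq_yz))
    ta.xz_eq_yz (tb.xz_eq_xy.symm.trans tb.xz_eq_yz) tb.xz_eq_yz
    ta.comm_xy ta.comm_xz tb.comm_xy tb.comm_xz ea.sq eb.sq ea'.sq eb'.sq
    ea.qpq_left eb.qpq_left ea'.qpq_left eb'.qpq_left
    (c hj hj (by omega) (by omega) ha hb) (c (by omega) (by omega) hla hlb ha hb)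
    (c hj (by omega) (by omega) hlb ha hb) (c hj (by omega) (by omega) hla hb ha)
    (c' hj (by omega) (by omega) ha (by omega) (by omega) (by omega)).symm
    (c' hj (by omega) (by omega) hb (by omega) (by omega) (by omega)).symm
    (c' (by omega) hj hla ha (by omega) (by omega) (by omega))
    (c' (by omega) hj hlb hb (by omega) (by omega) (by omega))

theorem commute_s_T_mul_T (P : PartitionAlgebra k A) {j a b : ℕ} (hj : 1 ≤ j)
    (hja : j + 1 < a) (ha : a ≤ k) (hjb : j + 1 < b) (hb : b ≤ k) :
    Commute (P.s j) (P.T j a b * P.T (j + 1) a b) := by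
  have hs := P.s_sq' hj (by omega)
  have hT : conjHom _ hs (P.T j a b) = P.T (j + 1) a b := by
    rw [T, map_twist, P.conj_Q_left hj hja ha, P.conj_Q_left hj hjb hb,
      P.conj_p_self hj (by omega), T]
  have hc : Commute (P.T j a b) (P.T (j + 1) a b) :=
    commute_twist
      (P.commute_Q_T hj (by omega) hja ha (by omega) ha (by omega) hb).symm
      (P.commute_Q_T hj (by omega) hjb hb (by omega) ha (by omega) hb).symm
      (P.commute_p_T hj (by omega) (by omega) (by omega) (by omega) (by omega) (by omega) ha
        (by omega) hb).symm
  refine (conjHom_eq_iff hs).1 ?_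
  rw [map_mul, hT, ← hT, conjHom_conjHom, hT, hc.eq]

/-- Elements commuting with the generators of `A_m` commute with `L_m` and `σ_m`. -/
theorem commute_LS (P : PartitionAlgebra k A) {x : A} (m : ℕ)
    (hs : ∀ i, 1 ≤ i → i < m → Commute x (P.s i))
    (hq : ∀ i, 1 ≤ i → i < m → Commute x (P.q i))
    (hp : ∀ i, 1 ≤ i → i ≤ m → Commute x (P.p i)) :
    Commute x (P.LS m).1 ∧ Commute x (P.LS m).2 := by
  induction m using Nat.strong_induction_on with
  | _ m ih =>
  match m with
  | 0 => exact ⟨Commute.zero_right x, Commute.one_right x⟩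
  | 1 => exact ⟨hp 1 le_rfl le_rfl, Commute.one_right x⟩
  | n + 2 =>
    obtain ⟨hL, hS⟩ := ih (n + 1) (by omega) (fun i h1 h2 => hs i h1 (by omega))
      (fun i h1 h2 => hq i h1 (by omega)) (fun i h1 h2 => hp i h1 (by omega))
    obtain ⟨hL', -⟩ := ih n (by omega) (fun i h1 h2 => hs i h1 (by omega))
      (fun i h1 h2 => hq i h1 (by omega)) (fun i h1 h2 => hp i h1 (by omega))
    have s1 := hs (n + 1) (by omega) (by omega)
    have q1 := hq (n + 1) (by omega) (by omega)
    have p1 := hp (n + 1) (by omega) (by omega)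
    have p2 := hp (n + 2) (by omega) (by omega)
    have h2 : Commute x (P.LS (n + 2)).2 := by
      rw [LS]
      dsimp only
      split_ifs with h
      · exact hs 1 le_rfl (by omega)
      · have s0 := hs n (by omega) (by omega)
        have q0 := hq n (by omega) (by omega)
        exact (((((((s0.mul_right s1).mul_right hS).mul_right s1).mul_right s0).add_right
          (((((s1.mul_right q0).mul_right hL').mul_right s1).mul_right q0).mul_right s1)).add_right
          (((q0.mul_right hL').mul_right s1).mul_right q0)).sub_right
          ((((((s1.mul_right q0).mul_right hL').mul_right s0).mul_right q1).mul_right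
            p1).mul_right q0)).sub_right
          ((((((q0.mul_right p1).mul_right q1).mul_right s0).mul_right hL').mul_right
            q0).mul_right s1)
    refine ⟨?_, h2⟩
    rw [LS] at h2 ⊢
    dsimp only at h2 ⊢
    exact (((((s1.mul_right hL).mul_right q1).neg_right.sub_right
      ((q1.mul_right hL).mul_right s1)).add_right
      (((q1.mul_right hL).mul_right p2).mul_right q1)).add_right
      ((s1.mul_right hL).mul_right s1)).add_right h2

theorem commute_p_L (P : PartitionAlgebra k A) {l m : ℕ} (hlm : m < l) (hl : l ≤ k) :
    Commute (P.p l) (P.L m) :=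
  (P.commute_LS m
    (fun _ _ _ => (P.s_p _ _ (by omega) (by omega) (by omega) hl (by omega) (by omega)).symm)
    (fun _ _ _ => (P.q_p _ _ (by omega) (by omega) (by omega) hl (by omega) (by omega)).symm)
    (fun _ _ _ => P.p_comm _ _ (by omega) hl (by omega) (by omega))).1

theorem commute_s_L (P : PartitionAlgebra k A) {l m : ℕ} (hlm : m < l) (hl : l < k) :
    Commute (P.s l) (P.L m) :=
  (P.commute_LS m
    (fun _ _ _ => P.s_comm _ _ (by omega) (by omega) (by omega) (by omega) (by omega) (by omega))
    (fun _ _ _ => P.s_q' _ _ (by omega) (by omega) (by omega) (by omega) (by omega) (by omega))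
    (fun _ _ _ => P.s_p _ _ (by omega) (by omega) (by omega) (by omega) (by omega) (by omega))).1

theorem L_add_two (P : PartitionAlgebra k A) (n : ℕ) :
    P.L (n + 2) = -(P.s (n + 1) * P.L (n + 1) * P.q (n + 1))
        - P.q (n + 1) * P.L (n + 1) * P.s (n + 1)
        + P.q (n + 1) * P.L (n + 1) * P.p (n + 2) * P.q (n + 1)
        + P.s (n + 1) * P.L (n + 1) * P.s (n + 1) + P.sig (n + 2) := by
  simp only [L, sig]
  rw [LS]

theorem sig_add_three (P : PartitionAlgebra k A) (n : ℕ) :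
    P.sig (n + 3) = P.s (n + 1) * P.s (n + 2) * P.sig (n + 2) * P.s (n + 2) * P.s (n + 1)
          + P.s (n + 2) * P.q (n + 1) * P.L (n + 1) * P.s (n + 2) * P.q (n + 1) * P.s (n + 2)
          + P.q (n + 1) * P.L (n + 1) * P.s (n + 2) * P.q (n + 1)
          - P.s (n + 2) * P.q (n + 1) * P.L (n + 1) * P.s (n + 1) * P.q (n + 2) * P.p (n + 2)
            * P.q (n + 1)
          - P.q (n + 1) * P.p (n + 2) * P.q (n + 2) * P.s (n + 1) * P.L (n + 1) * P.q (n + 1)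
            * P.s (n + 2) := by
  simp only [L, sig]
  rw [LS]
  simp

theorem conj_Y (P : PartitionAlgebra k A) {m a : ℕ} (hma : m + 1 < a) (ha : a < k)
    (h₁ : P.s a * P.s a = 1) (h₂ : P.s (a - 1) * P.s (a - 1) = 1) :
    conjHom _ h₂ (conjHom _ h₁ (P.Y m (a - 1) a)) = P.Y m a (a + 1) :=
  P.map_Y ((conjHom _ h₂).comp (conjHom _ h₁)) fun _ _ _ =>
    P.conj_T (by omega) (by omega) ha h₁ h₂

/-- Exchanging the values at `c`, `d` agrees with exchanging those at `a`, `b` once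
`a` is joined to `c` and `b` to `d`. -/
theorem Q_mul_Q_mul_Y (P : PartitionAlgebra k A) {m a b c d : ℕ} (hc : m < c) (hd : m < d)
    (hca : c < a) (hdb : d < b) (ha : a ≤ k) (hb : b ≤ k) :
    P.Q c a * P.Q d b * P.Y m c d = P.Q c a * P.Q d b * P.Y m a b := by
  refine P.mul_Y_congr (fun j h1 h2 => ?_) (fun j h1 h2 => ?_)
  · exact (P.commute_Q_T h1 (by omega) hca ha (by omega) ha (by omega) hb).mul_left
      (P.commute_Q_T h1 (by omega) hdb hb (by omega) ha (by omega) hb)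
  · have tc := P.tripleRel h1 (show j < c by omega) hca ha
    have td := P.tripleRel h1 (show j < d by omega) hdb hb
    have hcd : Commute (P.Q c a) (P.Q d b) :=
      P.commute_Q_Q (by omega) hca ha (by omega) hdb hb
    have key : ∀ {l : ℕ}, j < l → l ≤ k → Commute (P.Q c a * P.Q d b) (P.Q j l) :=
      fun hl hlk => (P.commute_Q_Q (by omega) hca ha h1 hl hlk).mul_left
        (P.commute_Q_Q (by omega) hdb hb h1 hl hlk)
    refine mul_twist_congr ?_ ?_ (key (by omega) ha) (key (by omega) hb)
      ((P.commute_p_Q (by omega) hca ha h1 (by omega) (by omega) (by omega)).symm.mul_left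
        (P.commute_p_Q (by omega) hdb hb h1 (by omega) (by omega) (by omega)).symm)
    · rw [hcd.eq, mul_assoc, mul_assoc, ← tc.comm_xz.eq, tc.xz_eq_yz, tc.comm_yz.eq]
    · rw [mul_assoc, mul_assoc, ← td.comm_xz.eq, td.xz_eq_yz, td.comm_yz.eq]

theorem mul_L_mul_step (P : PartitionAlgebra k A) {m a b : ℕ} (ha : m + 2 < a) (hb : m + 2 < b)
    (hak : a ≤ k) (hbk : b ≤ k)
    (hX : P.s (m + 1) * P.sig (m + 2) = P.Y m (m + 1) (m + 2))
    (hE : P.Q (m + 1) a * P.L (m + 1) * P.Q (m + 1) b =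
      P.Y m a b * (P.Q (m + 1) a * P.p (m + 1) * P.Q (m + 1) b)) :
    P.Q (m + 2) a * P.L (m + 2) * P.Q (m + 2) b =
      P.Y (m + 1) a b * (P.Q (m + 2) a * P.p (m + 2) * P.Q (m + 2) b) := by
  have hs := P.s_sq' (m := m + 1) (by omega) (by omega)
  have ta := P.tripleRel (i := m + 1) (j := m + 2) (by omega) (by omega) ha hak
  have tb := P.tripleRel (i := m + 1) (j := m + 2) (by omega) (by omega) hb hbk
  have pa := P.pairRel (i := m + 1) (j := a) (by omega) (by omega) hak
  have pb := P.pairRel (i := m + 2) (j := b) (by omega) (by omega) hbk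
  have hq : P.Q (m + 1) (m + 2) = P.q (m + 1) := P.Q_succ_self _
  rw [hq] at ta tb
  have cYQ : ∀ {i l : ℕ}, m < i → i < l → l ≤ k → Commute (P.Y m a b) (P.Q i l) :=
    fun h1 h2 h3 => (P.commute_Y fun j _ _ => P.commute_Q_T (by omega) (by omega) h2 h3
      (by omega) hak (by omega) hbk).symm
  have cYs : Commute (P.s (m + 1)) (P.Y m a b) :=
    P.commute_Y fun j _ _ => P.commute_s_T (by omega) (by omega) (by omega) hak (by omega) hbk
  have hσ : P.sig (m + 2) = P.s (m + 1) * P.Y m (m + 1) (m + 2) := by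
    rw [← hX, ← mul_assoc, hs, one_mul]
  have hse : P.s (m + 1) * P.Q (m + 1) a = P.Q (m + 2) a * P.s (m + 1) :=
    (conjHom_eq_iff hs).1 (P.conj_Q_left (by omega) (by omega) hak hs)
  have cY' : Commute (P.Q (m + 2) b) (P.Y m (m + 1) (m + 2)) :=
    P.commute_Y fun j _ _ => P.commute_Q_T (by omega) (by omega) hb hbk
      (by omega) (by omega) (by omega) (by omega)
  rw [P.L_add_two, show P.Y (m + 1) a b = P.Y m a b * twist (P.Q (m + 1) a) (P.Q (m + 1) b)
    (P.p (m + 1)) from rfl]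
  refine sandwich_step hs hse
    ((conjHom_eq_iff hs).1 (P.conj_Q_left (by omega) (by omega) hbk hs))
    ((conjHom_eq_iff hs).1 (P.conj_p_self (by omega) (by omega) hs))
    (P.s_q _ (by omega) (by omega)) (P.q_s _ (by omega) (by omega))
    ta.xz_eq_yz tb.xz_eq_yz ta.comm_xz cYs
    (cYQ (by omega) ha hak)
    (P.commute_Y fun j _ _ => P.commute_p_T (by omega) (by omega) (by omega) (by omega)
      (by omega) (by omega) (by omega) hak (by omega) hbk).symm
    (P.commute_p_L (by omega) (by omega)).symm ta.comm_yz
    (P.commute_Q_Q (by omega) (by omega) hak (by omega) hb hbk)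
    (P.commute_Q_Q (by omega) (by omega) hbk (by omega) ha hak)
    ta.comm_az tb.comm_az ta.comm_by.symm tb.comm_by.symm
    (P.p_comm _ _ (by omega) (by omega) (by omega) (by omega)) hE ?_
    (P.s_pp _ (by omega) (by omega)) pa.qpq_left pb.qpq_left
  rw [hσ]
  calc P.Q (m + 2) a * (P.s (m + 1) * P.Y m (m + 1) (m + 2)) * P.Q (m + 2) b
      = P.Q (m + 2) a * P.s (m + 1) * (P.Y m (m + 1) (m + 2) * P.Q (m + 2) b) := by noncomm_ring
    _ = P.s (m + 1) * (P.Q (m + 1) a * P.Q (m + 2) b * P.Y m (m + 1) (m + 2)) := by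
      rw [← cY'.eq, ← hse]; noncomm_ring
    _ = P.s (m + 1) * (P.Q (m + 1) a * (P.Q (m + 2) b * P.Y m a b)) := by
      rw [P.Q_mul_Q_mul_Y (by omega) (by omega) (by omega) hb hak hbk]; noncomm_ring
    _ = P.s (m + 1) * (P.Q (m + 1) a * P.Y m a b) * P.Q (m + 2) b := by
      rw [← (cYQ (by omega) hb hbk).eq]; noncomm_ring
    _ = (P.s (m + 1) * P.Y m a b) * P.Q (m + 1) a * P.Q (m + 2) b := by
      rw [← (cYQ (by omega) (by omega) hak).eq]; noncomm_ring
    _ = P.Y m a b * (P.s (m + 1) * P.Q (m + 1) a * P.Q (m + 2) b) := by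
      rw [cYs.eq]; noncomm_ring

theorem s_mul_sig_step (P : PartitionAlgebra k A) {m : ℕ} (hm : m + 3 ≤ k)
    (hX : P.s (m + 1) * P.sig (m + 2) = P.Y m (m + 1) (m + 2))
    (hE : ∀ a b, m + 1 < a → m + 1 < b → a ≤ k → b ≤ k →
      P.Q (m + 1) a * P.L (m + 1) * P.Q (m + 1) b =
        P.Y m a b * (P.Q (m + 1) a * P.p (m + 1) * P.Q (m + 1) b)) :
    P.s (m + 2) * P.sig (m + 3) = P.Y (m + 1) (m + 2) (m + 3) := by
  have hs := P.s_sq' (m := m + 1) (by omega) (by omega)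
  have hs' := P.s_sq' (m := m + 2) (by omega) (by omega)
  have hY := P.conj_Y (m := m) (a := m + 2) (by omega) (by omega) hs' hs
  have hab := hE (m + 2) (m + 3) (by omega) (by omega) (by omega) hm
  have hba := hE (m + 3) (m + 2) (by omega) (by omega) hm (by omega)
  rw [P.Y_comm] at hba
  have he : P.Q (m + 1) (m + 2) = P.q (m + 1) := P.Q_succ_self _
  have he' : P.Q (m + 2) (m + 3) = P.q (m + 2) := P.Q_succ_self _
  have pe := P.pairRel (i := m + 1) (j := m + 2) (by omega) (by omega) (by omega)
  have pf := P.pairRel (i := m + 1) (j := m + 3) (by omega) (by omega) hm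
  have hfe : P.s (m + 1) * P.Q (m + 1) (m + 3) = P.q (m + 2) * P.s (m + 1) := by
    rw [← he']
    exact (conjHom_eq_iff hs).1 (P.conj_Q_left (by omega) (by omega) hm hs)
  have hef : P.s (m + 2) * P.q (m + 1) = P.Q (m + 1) (m + 3) * P.s (m + 2) := by
    rw [← he]
    exact (conjHom_eq_iff hs').1 (P.conj_Q_right (by omega) hs')
  have hp : P.s (m + 1) * P.p (m + 1) = P.p (m + 2) * P.s (m + 1) :=
    (conjHom_eq_iff hs).1 (P.conj_p_self (by omega) (by omega) hs)
  have hp' : P.s (m + 2) * P.p (m + 1) = P.p (m + 1) * P.s (m + 2) :=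
    P.s_p _ _ (by omega) (by omega) (by omega) (by omega) (by omega) (by omega)
  have cL : Commute (P.s (m + 2)) (P.L (m + 1)) := P.commute_s_L (by omega) (by omega)
  have hse : P.s (m + 1) * P.q (m + 1) = P.q (m + 1) := P.s_q _ (by omega) (by omega)
  have hes : P.q (m + 1) * P.s (m + 1) = P.q (m + 1) := P.q_s _ (by omega) (by omega)
  have cY : Commute (P.Q (m + 1) (m + 3) * P.p (m + 1)) (P.Y m (m + 2) (m + 3)) :=
    P.commute_Y fun j _ _ =>
      (P.commute_Q_T (by omega) (by omega) (by omega) hm (by omega) (by omega) (by omega)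
        hm).mul_left
      (P.commute_p_T (by omega) (by omega) (by omega) (by omega) (by omega) (by omega) (by omega)
        (by omega) (by omega) hm)
  rw [P.sig_add_three, show P.Y (m + 1) (m + 2) (m + 3) = P.Y m (m + 2) (m + 3) *
    twist (P.Q (m + 1) (m + 2)) (P.Q (m + 1) (m + 3)) (P.p (m + 1)) from rfl]
  rw [he] at hab hba pe ⊢
  exact sigma_step hs hs' (P.s_braid (by omega) (by omega)) hX hY hab hba
    pe.qpq_left pf.pqp_left pf.qpq_left pe.pqp_left hfe hef hp hp' cL hse hes cY

/-- `σ_{m+2}` is a product of transpositions of values, and sandwiching `L_{m+1}` expresses it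
through the same products. -/
theorem sig_and_L_formula (P : PartitionAlgebra k A) (m : ℕ) (hm : m + 2 ≤ k) :
    P.s (m + 1) * P.sig (m + 2) = P.Y m (m + 1) (m + 2) ∧
    ∀ a b, m + 1 < a → m + 1 < b → a ≤ k → b ≤ k →
      P.Q (m + 1) a * P.L (m + 1) * P.Q (m + 1) b =
        P.Y m a b * (P.Q (m + 1) a * P.p (m + 1) * P.Q (m + 1) b) := by
  induction m with
  | zero =>
    refine ⟨?_, fun a b _ _ _ _ => ?_⟩
    · have : P.sig 2 = P.s 1 := by simp [sig, LS]
      simpa [this, Y] using P.s_sq' (m := 1) le_rfl (by omega)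
    · simp [L, LS, Y]
  | succ m ih =>
    obtain ⟨hX, hE⟩ := ih (by omega)
    exact ⟨P.s_mul_sig_step hm hX hE, fun a b ha hb hak hbk =>
      P.mul_L_mul_step ha hb hak hbk hX (hE a b (by omega) (by omega) hak hbk)⟩

theorem commute_sig (P : PartitionAlgebra k A) {x : A} {m : ℕ} (hm : m + 4 ≤ k)
    (hs : Commute x (P.s (m + 3)))
    (hY : ∀ j, 1 ≤ j → j ≤ m → Commute x (P.T j (m + 3) (m + 4)))
    (hT : Commute x (P.T (m + 1) (m + 3) (m + 4) * P.T (m + 2) (m + 3) (m + 4))) :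
    P.sig (m + 4) * x = x * P.sig (m + 4) := by
  have hX := (P.sig_and_L_formula (m + 2) hm).1
  have h : P.sig (m + 4) = P.s (m + 3) * (P.Y m (m + 3) (m + 4) *
      (P.T (m + 1) (m + 3) (m + 4) * P.T (m + 2) (m + 3) (m + 4))) := by
    rw [← mul_assoc (P.Y m _ _)]
    change _ = P.s (m + 3) * P.Y (m + 2) (m + 3) (m + 4)
    rw [← hX, ← mul_assoc, P.s_sq' (by omega) (by omega), one_mul]
  rw [h]
  exact (hs.mul_right ((P.commute_Y hY).mul_right hT)).eq.symm

end PartitionAlgebra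

/-- Theorem 3.6(3)–(5): `σ_{i+1}` commutes with `p_{i-3/2}`, `s_{i-2}` and `p_{i-2}`
for `3 ≤ i ≤ k-1`. -/
theorem partitionAlgebra_sig_comm_far {k : ℕ} (hk : 4 ≤ k) {A : Type*} [Ring A]
    [Algebra (Polynomial ℤ) A] (P : PartitionAlgebra k A) :
    ∀ i, 3 ≤ i → i ≤ k - 1 →
      P.sig (i + 1) * P.q (i - 2) = P.q (i - 2) * P.sig (i + 1) ∧
      P.sig (i + 1) * P.s (i - 2) = P.s (i - 2) * P.sig (i + 1) ∧
      P.sig (i + 1) * P.p (i - 2) = P.p (i - 2) * P.sig (i + 1) := by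
  intro i hi hik
  obtain ⟨m, rfl⟩ : ∃ m, i = m + 3 := ⟨i - 3, by omega⟩
  simp only [show m + 3 - 2 = m + 1 by omega]
  have hs := P.s_sq' (m := m + 1) (by omega) (by omega)
  have hq : P.Q (m + 1) (m + 2) = P.q (m + 1) := P.Q_succ_self _
  have h3 := P.pairRel (i := m + 1) (j := m + 3) (by omega) (by omega) (by omega)
  have h4 := P.pairRel (i := m + 1) (j := m + 4) (by omega) (by omega) (by omega)
  refine ⟨P.commute_sig (by omega) ?_ (fun j _ _ => ?_) ?_,
    P.commute_sig (by omega) ?_ (fun j _ _ => ?_) ?_,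
    P.commute_sig (by omega) ?_ (fun j _ _ => ?_) ?_⟩
  · exact (P.s_q' _ _ (by omega) (by omega) (by omega) (by omega) (by omega) (by omega)).symm
  · rw [← hq]
    exact P.commute_Q_T (by omega) (by omega) (by omega) (by omega) (by omega) (by omega)
      (by omega) (by omega)
  · rw [← hq]
    exact P.commute_q_T_mul_T (by omega) (by omega) (by omega) (by omega) (by omega) (by omega)
  · exact P.s_comm _ _ (by omega) (by omega) (by omega) (by omega) (by omega) (by omega)
  · exact P.commute_s_T (by omega) (by omega) (by omega) (by omega) (by omega) (by omega)
  · exact P.commute_s_T_mul_T (by omega) (by omega) (by omega) (by omega) (by omega)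
  · exact (P.s_p _ _ (by omega) (by omega) (by omega) (by omega) (by omega) (by omega)).symm
  · exact P.commute_p_T (by omega) (by omega) (by omega) (by omega) (by omega) (by omega)
      (by omega) (by omega) (by omega) (by omega)
  · exact (PartitionAlgebra.commute_p_twist h3.pqp_left h4.pqp_left).mul_right
      (P.commute_p_T (by omega) (by omega) (by omega) (by omega) (by omega) (by omega)
      (by omega) (by omega) (by omega) (by omega))
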